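/- Let F be a labelled graph with m = |F| ≥ 1 vertices, let W be a graphon, let p ∈ [0,1], and let α_1,…,α_m ∈ (0,1) with Σ_{i=1}^m α_i ≤ 1. (a) If (α_1,…,α_m) ≠ (1/m,…,1/m), then W satisfies P̃^W(F;α_1,…,α_m) if and only if Ψ̃_{F,W}(x_1,…,x_m) = p^{e(F)} for a.e. (x_1,…,x_m) ∈ [0,1]^m. (b) If (α_1,…,α_m) = (1/m,…,1/m), then W satisfies P̃^W(F;α_1,…,α_m) if and only if there exists an integrable function h : [0,1] → ℝ with ∫₀¹ h = p^{e(F)}/m such that Ψ̃_{F,W}(x_1,…,x_m) = Σ_{i=1}^m h(x_i) for a.e. (x_1,…,x_m). -/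

import Mathlib

open Filter Finset Asymptotics MeasureTheory

/-- `numEdges F` is `e(F)`, the number of edges of `F`. -/
noncomputable def numEdges {m : ℕ} (F : SimpleGraph (Fin m)) : ℕ := Nat.card F.edgeSet

/-- A graphon: a symmetric measurable function `[0,1]² → [0,1]`
(encoded as a function on all of `ℝ × ℝ`). -/
def IsGraphon (W : ℝ → ℝ → ℝ) : Prop :=
  Measurable (Function.uncurry W) ∧ (∀ x y, W x y = W y x) ∧
    ∀ x y, W x y ∈ Set.Icc (0 : ℝ) 1

open Classical in
/-- `Ψ_{F,W}(x₁,…,x_m) = ∏_{ij ∈ E(F)} W(x_i,x_j)`. -/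
noncomputable def psi {m : ℕ} (F : SimpleGraph (Fin m)) (W : ℝ → ℝ → ℝ)
    (x : Fin m → ℝ) : ℝ :=
  ∏ i : Fin m, ∏ j : Fin m, if i < j ∧ F.Adj i j then W (x i) (x j) else 1

/-- `Ψ̃_{F,W}`, the symmetrization of `Ψ_{F,W}` over the `m` coordinates. -/
noncomputable def psiSym {m : ℕ} (F : SimpleGraph (Fin m)) (W : ℝ → ℝ → ℝ)
    (x : Fin m → ℝ) : ℝ :=
  ((m.factorial : ℝ))⁻¹ * ∑ σ : Equiv.Perm (Fin m), psi F W (fun i => x (σ i))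

/-- The unit cube `[0,1]^m`. -/
def unitBox (m : ℕ) : Set (Fin m → ℝ) := Set.univ.pi fun _ => Set.Icc (0 : ℝ) 1

/-- The unit square `[0,1]²`. -/
def unitSquare : Set (ℝ × ℝ) := Set.Icc (0 : ℝ) 1 ×ˢ Set.Icc (0 : ℝ) 1

/-- The graphon property `P^W(F;α₁,…,α_m)`:
`∫_{A₁×⋯×A_m} Ψ_{F,W} = p^(e F) ∏ λ(A_i)` for all pairwise disjoint measurable
`A₁,…,A_m ⊆ [0,1]` with `λ(A_i) = α_i`. -/
def GraphonP {m : ℕ} (F : SimpleGraph (Fin m)) (W : ℝ → ℝ → ℝ) (p : ℝ)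
    (α : Fin m → ℝ) : Prop :=
  ∀ A : Fin m → Set ℝ, (∀ i, MeasurableSet (A i)) → (∀ i, A i ⊆ Set.Icc 0 1) →
    Pairwise (fun i j => Disjoint (A i) (A j)) →
    (∀ i, volume (A i) = ENNReal.ofReal (α i)) →
    ∫ x in Set.univ.pi A, psi F W x = p ^ numEdges F * ∏ i, α i

/-- The graphon property `P̃^W(F;α₁,…,α_m)`: as `GraphonP` but with `Ψ̃_{F,W}`. -/
def GraphonPt {m : ℕ} (F : SimpleGraph (Fin m)) (W : ℝ → ℝ → ℝ) (p : ℝ)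
    (α : Fin m → ℝ) : Prop :=
  ∀ A : Fin m → Set ℝ, (∀ i, MeasurableSet (A i)) → (∀ i, A i ⊆ Set.Icc 0 1) →
    Pairwise (fun i j => Disjoint (A i) (A j)) →
    (∀ i, volume (A i) = ENNReal.ofReal (α i)) →
    ∫ x in Set.univ.pi A, psiSym F W x = p ^ numEdges F * ∏ i, α i

/-- The uniform probability measure on `[0,1]`, as a measure on `ℝ`. -/
noncomputable abbrev unif : Measure ℝ := volume.restrict (Set.Icc 0 1)

instance : IsProbabilityMeasure unif := ⟨by simp [unif]⟩

/-- The product of copies of the uniform measure on `[0,1]`, as a measure on `κ → ℝ`. -/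
noncomputable abbrev cube (κ : Type*) [Fintype κ] : Measure (κ → ℝ) := Measure.pi fun _ => unif

lemma exists_subset_unif_eq {E : Set ℝ} (hE : MeasurableSet E) {t : ℝ} (ht0 : 0 ≤ t)
    (ht : t ≤ unif.real E) : ∃ E' ⊆ E, MeasurableSet E' ∧ unif.real E' = t := by
  have hlip : LipschitzWith 1 fun s => unif.real (E ∩ Set.Iic s) := by
    refine LipschitzWith.of_le_add fun s r => ?_
    have hsub : E ∩ Set.Iic s ⊆ (E ∩ Set.Iic r) ∪ Set.Ioc r s := by
      rintro x ⟨hx, hxs⟩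
      by_cases h : x ≤ r
      · exact Or.inl ⟨hx, h⟩
      · exact Or.inr ⟨not_le.1 h, hxs⟩
    have h1 : unif.real (Set.Ioc r s) ≤ dist s r := by
      have : unif.real (Set.Ioc r s) ≤ volume.real (Set.Ioc r s) :=
        ENNReal.toReal_mono (by simp) (Measure.restrict_apply_le _ _)
      refine this.trans ?_
      rw [Real.volume_real_Ioc, Real.dist_eq]
      exact max_le (le_abs_self _) (abs_nonneg _)
    exact (measureReal_mono hsub).trans ((measureReal_union_le _ _).trans (by gcongr))
  have hcont : ContinuousOn (fun s => unif.real (E ∩ Set.Iic s)) (Set.Icc 0 1) :=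
    hlip.continuous.continuousOn
  have h0 : unif.real (E ∩ Set.Iic 0) = 0 := by
    have : unif (E ∩ Set.Iic 0) = 0 := by
      rw [Measure.restrict_apply (hE.inter measurableSet_Iic)]
      refine measure_mono_null (t := {0}) ?_ (by simp)
      rintro x ⟨⟨-, h1⟩, h2, -⟩
      exact le_antisymm h1 h2
    simp [Measure.real, this]
  have h1 : unif.real (E ∩ Set.Iic 1) = unif.real E := by
    have : unif (E ∩ Set.Iic 1) = unif E := by
      rw [Measure.restrict_apply (hE.inter measurableSet_Iic), Measure.restrict_apply hE]
      congr 1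
      ext x
      simp only [Set.mem_inter_iff, Set.mem_Iic, Set.mem_Icc]
      tauto
    simp [Measure.real, this]
  obtain ⟨s, -, hs⟩ := intermediate_value_Icc zero_le_one hcont
    (show t ∈ Set.Icc _ _ by simp only [h0, h1]; exact ⟨ht0, ht⟩)
  exact ⟨E ∩ Set.Iic s, Set.inter_subset_left, hE.inter measurableSet_Iic, hs⟩

/-- Disjoint measurable sets of prescribed measures can be found inside any large enough set. -/
lemma exists_disjoint_family {ι : Type*} [DecidableEq ι] (K : Finset ι) (γ : ι → ℝ)
    (hγ : ∀ k ∈ K, 0 ≤ γ k) {R : Set ℝ} (hR : MeasurableSet R)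
    (hle : ∑ k ∈ K, γ k ≤ unif.real R) :
    ∃ A : ι → Set ℝ, (∀ k, MeasurableSet (A k)) ∧ (∀ k, A k ⊆ R) ∧
      Pairwise (fun i j => Disjoint (A i) (A j)) ∧ (∀ k ∈ K, unif.real (A k) = γ k) ∧
      ∀ k ∉ K, A k = ∅ := by
  induction K using Finset.induction_on generalizing R with
  | empty => exact ⟨fun _ => ∅, by simp, by simp, fun i j _ => by simp, by simp, by simp⟩
  | insert a K ha ih =>
    rw [Finset.sum_insert ha] at hle
    have hK : 0 ≤ ∑ k ∈ K, γ k :=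
      Finset.sum_nonneg fun k hk => hγ k (Finset.mem_insert_of_mem hk)
    obtain ⟨E, hER, hE, hEγ⟩ := exists_subset_unif_eq hR (hγ a (Finset.mem_insert_self a K))
      (by linarith)
    obtain ⟨A, hA, hAR, hAd, hAγ, hA0⟩ := ih (fun k hk => hγ k (Finset.mem_insert_of_mem hk))
      (R := R \ E) (hR.diff hE) (by rw [measureReal_sdiff hER hE]; linarith)
    have hdE : ∀ k, Disjoint E (A k) := fun k =>
      Set.disjoint_left.2 fun x hx hx' => (hAR k hx').2 hx
    refine ⟨Function.update A a E, fun k => ?_, fun k => ?_, fun i j hij => ?_, fun k hk => ?_,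
      fun k hk => ?_⟩
    · rcases eq_or_ne k a with rfl | h <;> simp [*]
    · rcases eq_or_ne k a with rfl | h
      · simpa using hER
      · simpa [h] using (hAR k).trans Set.sdiff_subset
    · rcases eq_or_ne i a with rfl | hi
      · simpa [hij.symm] using hdE j
      · rcases eq_or_ne j a with rfl | hj
        · simpa [hi] using (hdE i).symm
        · simpa [hi, hj] using hAd hij
    · rcases eq_or_ne k a with rfl | h
      · simpa using hEγ
      · simpa [h] using hAγ k ((Finset.mem_insert.1 hk).resolve_left h)
    · rw [Finset.mem_insert, not_or] at hk
      simpa [hk.1] using hA0 k hk.2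

section Additive

variable {B : Set ℝ} {ν : Set ℝ → ℝ} {C : ℝ}

lemma additive_eq_zero (hC : ∀ E ⊆ B, MeasurableSet E → |ν E| ≤ C * unif.real E) (hC0 : 0 ≤ C)
    (hadd : ∀ E E', E ⊆ B → E' ⊆ B → MeasurableSet E → MeasurableSet E' → Disjoint E E' →
      ν (E ∪ E') = ν E + ν E') {b : ℝ} (hb : 0 < b) {N : ℕ}
    (hν : ∀ n : ℕ, N < n → ∀ E ⊆ B, MeasurableSet E → unif.real E = b / n → ν E = 0)
    {E : Set ℝ} (hE : MeasurableSet E) (hEB : E ⊆ B) : ν E = 0 := by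
  have key : ∀ n : ℕ, N < n → |ν E| ≤ C * (b / n) := by
    intro n hn
    have hn0 : (0 : ℝ) < n := by exact_mod_cast (Nat.zero_le N).trans_lt hn
    have ht : 0 < b / n := by positivity
    have step : ∀ j : ℕ, ∀ E ⊆ B, MeasurableSet E → unif.real E ≤ j * (b / n) →
        |ν E| ≤ C * (b / n) := by
      intro j
      induction j with
      | zero =>
        intro E hEB hE hj
        refine (hC E hEB hE).trans ?_
        gcongr
        simp only [Nat.cast_zero, zero_mul] at hj
        linarith
      | succ j ih =>
        intro E hEB hE hj
        rcases le_total (unif.real E) (b / n) with h | h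
        · exact (hC E hEB hE).trans (by gcongr)
        · obtain ⟨E', hE'E, hE', hE't⟩ := exists_subset_unif_eq hE ht.le h
          have := hadd (E \ E') E' (Set.sdiff_subset.trans hEB) (hE'E.trans hEB) (hE.diff hE') hE'
            Set.disjoint_sdiff_left
          rw [Set.sdiff_union_of_subset hE'E, hν n hn E' (hE'E.trans hEB) hE' hE't, add_zero]
            at this
          rw [this]
          refine ih _ (Set.sdiff_subset.trans hEB) (hE.diff hE') ?_
          rw [measureReal_sdiff hE'E hE', hE't]
          push_cast at hj
          linarith
    obtain ⟨j, hj⟩ := exists_nat_ge (unif.real E / (b / n))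
    exact step j E hEB hE ((div_le_iff₀ ht).1 hj)
  have hlim : Tendsto (fun n : ℕ => C * (b / n)) atTop (nhds (C * 0)) :=
    (tendsto_const_div_atTop_nhds_zero_nat b).const_mul C
  rw [mul_zero] at hlim
  exact abs_nonpos_iff.1 (ge_of_tendsto hlim ((eventually_gt_atTop N).mono key))

/-- A bounded additive set function which agrees on disjoint small sets of equal measure is
proportional to the uniform measure. -/
lemma additive_eq_of_swap (hB : MeasurableSet B)
    (hC : ∀ E ⊆ B, MeasurableSet E → |ν E| ≤ C * unif.real E)
    (hadd : ∀ E E', E ⊆ B → E' ⊆ B → MeasurableSet E → MeasurableSet E' → Disjoint E E' →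
      ν (E ∪ E') = ν E + ν E') {t₀ : ℝ} (ht₀ : 0 < t₀)
    (hsw : ∀ E E', E ⊆ B → E' ⊆ B → MeasurableSet E → MeasurableSet E' → Disjoint E E' →
      unif.real E = unif.real E' → unif.real E ≤ t₀ → ν E = ν E')
    {E : Set ℝ} (hE : MeasurableSet E) (hEB : E ⊆ B) :
    ν E * unif.real B = ν B * unif.real E := by
  have hνB := hC B subset_rfl hB
  rcases measureReal_nonneg.eq_or_lt (a := 0) (b := unif.real B) with hb | hb
  · rw [← hb, mul_zero, abs_nonpos_iff] at hνB
    rw [← hb, hνB]; simp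
  set b := unif.real B with hbdef
  have hmul : ∀ j : ℕ, 1 ≤ j → ∀ {t : ℝ} {E F : Set ℝ}, 0 ≤ t → t ≤ t₀ → E ⊆ B → F ⊆ B →
      MeasurableSet E → MeasurableSet F → Disjoint E F → unif.real E = t →
      unif.real F = j * t → ν F = j * ν E := by
    intro j hj
    induction j, hj using Nat.le_induction with
    | base =>
      intro t E F ht ht' hEB hFB hE hF hd hEt hFt
      simp only [Nat.cast_one, one_mul] at hFt ⊢
      exact (hsw E F hEB hFB hE hF hd (hEt.trans hFt.symm) (hEt.trans_le ht')).symm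
    | succ j hj ih =>
      intro t E F ht ht' hEB hFB hE hF hd hEt hFt
      push_cast at hFt
      obtain ⟨F', hF'F, hF', hF't⟩ := exists_subset_unif_eq hF (t := t) ht (by
        rw [hFt]; nlinarith [mul_nonneg (Nat.cast_nonneg (α := ℝ) j) ht])
      have h1 := hadd (F \ F') F' (Set.sdiff_subset.trans hFB) (hF'F.trans hFB) (hF.diff hF') hF'
            Set.disjoint_sdiff_left
      rw [Set.sdiff_union_of_subset hF'F,
        ih ht ht' hEB (Set.sdiff_subset.trans hFB) hE (hF.diff hF')
          (hd.mono_right Set.sdiff_subset) hEt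
          (by rw [measureReal_sdiff hF'F hF', hF't]; linarith),
        ← hsw E F' hEB (hF'F.trans hFB) hE hF' (hd.mono_right hF'F) (hEt.trans hF't.symm)
          (hEt.trans_le ht')] at h1
      rw [h1]; push_cast; ring
  obtain ⟨N, hN⟩ := exists_nat_gt (max 1 (b / t₀))
  have hC0 : 0 ≤ C := by
    by_contra h
    nlinarith [abs_nonneg (ν B)]
  have := additive_eq_zero (B := B) (ν := fun E => ν E * b - ν B * unif.real E)
    (C := C * b + |ν B|) ?_ (by positivity) ?_ hb (N := N) ?_ hE hEB
  · simpa [sub_eq_zero] using this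
  · intro E hEB hE
    calc |ν E * b - ν B * unif.real E| ≤ |ν E * b| + |ν B * unif.real E| := abs_sub _ _
      _ = |ν E| * b + |ν B| * unif.real E := by
        rw [abs_mul, abs_mul, abs_of_pos hb, abs_of_nonneg (a := unif.real E) measureReal_nonneg]
      _ ≤ _ := by nlinarith [hC E hEB hE]
  · intro E E' hEB hE'B hE hE' hd
    rw [hadd E E' hEB hE'B hE hE' hd, measureReal_union hd hE']
    ring
  · intro n hn E hEB hE hEt
    have hNn : (N : ℝ) < n := by exact_mod_cast hn
    have h1n : (1 : ℝ) < n := (le_max_left _ _).trans_lt (hN.trans hNn)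
    have hn0 : (0 : ℝ) < n := by linarith
    have htn : b / n ≤ t₀ := by
      rw [div_le_iff₀ hn0, mul_comm, ← div_le_iff₀ ht₀]
      exact ((le_max_right _ _).trans_lt (hN.trans hNn)).le
    have hn2 : 2 ≤ n := by exact_mod_cast h1n
    have hF := hmul (n - 1) (by omega) (F := B \ E) (by positivity) htn hEB Set.sdiff_subset hE
      (hB.diff hE) Set.disjoint_sdiff_right hEt (by
        rw [measureReal_sdiff hEB hE, hEt, Nat.cast_sub (by omega), ← hbdef,
          Nat.cast_one, sub_mul, one_mul, mul_div_cancel₀ _ hn0.ne'])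
    have h2 := hadd (B \ E) E Set.sdiff_subset hEB (hB.diff hE) hE Set.disjoint_sdiff_left
    rw [Set.sdiff_union_of_subset hEB, hF, Nat.cast_sub (by omega)] at h2
    rw [h2, hEt]
    field_simp
    push_cast
    ring

lemma additive_eq_zero_of_measure_eq (hB : MeasurableSet B)
    (hC : ∀ E ⊆ B, MeasurableSet E → |ν E| ≤ C * unif.real E)
    (hadd : ∀ E E', E ⊆ B → E' ⊆ B → MeasurableSet E → MeasurableSet E' → Disjoint E E' →
      ν (E ∪ E') = ν E + ν E') {β : ℝ} (hβ : 0 < β) (hβB : β < unif.real B)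
    (hν : ∀ E ⊆ B, MeasurableSet E → unif.real E = β → ν E = 0)
    {E : Set ℝ} (hE : MeasurableSet E) (hEB : E ⊆ B) : ν E = 0 := by
  have hprop : ∀ {E : Set ℝ}, MeasurableSet E → E ⊆ B →
      ν E * unif.real B = ν B * unif.real E := by
    refine additive_eq_of_swap hB hC hadd (t₀ := min β (unif.real B - β))
      (lt_min hβ (by linarith)) ?_
    intro E E' hEB hE'B hE hE' hd heq hle
    have h1 : unif.real E ≤ β := hle.trans (min_le_left _ _)
    have h2 : unif.real E ≤ unif.real B - β := hle.trans (min_le_right _ _)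
    obtain ⟨D, hDs, hD, hDm⟩ := exists_subset_unif_eq (hB.diff (hE.union hE'))
      (t := β - unif.real E) (by linarith) (by
        rw [measureReal_sdiff (Set.union_subset hEB hE'B) (hE.union hE'),
          measureReal_union hd hE']
        linarith)
    have hDB := hDs.trans Set.sdiff_subset
    have hdE : Disjoint E D := Set.disjoint_left.2 fun x hx hx' => (hDs hx').2 (Or.inl hx)
    have hdE' : Disjoint E' D := Set.disjoint_left.2 fun x hx hx' => (hDs hx').2 (Or.inr hx)
    have e1 := hν (E ∪ D) (Set.union_subset hEB hDB) (hE.union hD)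
      (by rw [measureReal_union hdE hD]; linarith)
    have e2 := hν (E' ∪ D) (Set.union_subset hE'B hDB) (hE'.union hD)
      (by rw [measureReal_union hdE' hD]; linarith)
    rw [hadd _ _ hEB hDB hE hD hdE] at e1
    rw [hadd _ _ hE'B hDB hE' hD hdE'] at e2
    linarith
  obtain ⟨D, hDB, hD, hDm⟩ := exists_subset_unif_eq hB hβ.le hβB.le
  have h1 := hprop hD hDB
  rw [hν D hDB hD hDm, zero_mul, hDm, eq_comm, mul_eq_zero] at h1
  have h2 := hprop hE hEB
  rw [h1.resolve_right hβ.ne', zero_mul, mul_eq_zero] at h2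
  exact h2.resolve_right (hβ.trans hβB).ne'

end Additive

section BoxIntegral

variable {κ : Type*} [Fintype κ] {g : (κ → ℝ) → ℝ} {C : ℝ}

/-- The integral of `g` over the box `∏ A_k`. -/
noncomputable def boxIntegral (g : (κ → ℝ) → ℝ) (A : κ → Set ℝ) : ℝ :=
  ∫ x in Set.univ.pi A, g x ∂cube κ

lemma integrable_of_bounded {Ω : Type*} [MeasurableSpace Ω] {μ : Measure Ω} [IsFiniteMeasure μ]
    {g : Ω → ℝ} (hg : Measurable g) (hC : ∀ x, |g x| ≤ C) : Integrable g μ :=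
  Integrable.of_bound hg.aestronglyMeasurable C (ae_of_all _ hC)

lemma boxIntegral_update_union [DecidableEq κ] (hg : Measurable g) (hC : ∀ x, |g x| ≤ C)
    {A : κ → Set ℝ} (hA : ∀ k, MeasurableSet (A k)) (k : κ) {E E' : Set ℝ}
    (hE' : MeasurableSet E') (hd : Disjoint E E') :
    boxIntegral g (Function.update A k (E ∪ E')) =
      boxIntegral g (Function.update A k E) + boxIntegral g (Function.update A k E') := by
  have hu : Set.univ.pi (Function.update A k (E ∪ E')) =
      Set.univ.pi (Function.update A k E) ∪ Set.univ.pi (Function.update A k E') := by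
    ext x
    simp only [Set.mem_union, Set.mem_univ_pi]
    constructor
    · intro h
      have hk := h k
      rw [Function.update_self] at hk
      refine hk.imp (fun hk j => ?_) fun hk j => ?_ <;>
      · rcases eq_or_ne j k with rfl | hj
        · simpa using hk
        · simpa [hj] using h j
    · rintro (h | h) j <;> have hj := h j <;> rcases eq_or_ne j k with rfl | hj' <;>
        simp_all
  have hm : MeasurableSet (Set.univ.pi (Function.update A k E')) := by
    refine MeasurableSet.univ_pi fun j => ?_
    rcases eq_or_ne j k with rfl | hj <;> simp [*]
  rw [boxIntegral, hu, setIntegral_union _ hm (integrable_of_bounded hg hC)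
    (integrable_of_bounded hg hC), boxIntegral, boxIntegral]
  refine Set.disjoint_left.2 fun x hx hx' => ?_
  have h1 := hx k (Set.mem_univ k)
  have h2 := hx' k (Set.mem_univ k)
  rw [Function.update_self] at h1 h2
  exact Set.disjoint_left.1 hd h1 h2

lemma abs_boxIntegral_le (hC : ∀ x, |g x| ≤ C) (A : κ → Set ℝ) (k : κ) :
    |boxIntegral g A| ≤ C * unif.real (A k) := by
  classical
  have hC0 : 0 ≤ C := (abs_nonneg _).trans (hC 0)
  have h := norm_setIntegral_le_of_norm_le_const (μ := cube κ) (s := Set.univ.pi A) (f := g)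
    (measure_lt_top _ _) fun x _ => hC x
  refine h.trans (mul_le_mul_of_nonneg_left ?_ hC0)
  rw [Measure.real, Measure.pi_pi, ENNReal.toReal_prod, ← Finset.mul_prod_erase _ _ (Finset.mem_univ k)]
  exact mul_le_of_le_one_right measureReal_nonneg
    (Finset.prod_le_one (fun _ _ => measureReal_nonneg) fun _ _ => measureReal_le_one)

lemma boxIntegral_eq_zero_of_le [DecidableEq κ] (hg : Measurable g) (hC : ∀ x, |g x| ≤ C)
    {β : κ → ℝ} (hβ : ∀ k, 0 < β k) (hsum : ∑ k, β k < 1)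
    (hQ : ∀ A : κ → Set ℝ, (∀ k, MeasurableSet (A k)) →
      Pairwise (fun i j => Disjoint (A i) (A j)) → (∀ k, unif.real (A k) = β k) →
      boxIntegral g A = 0) (S : Finset κ) :
    ∀ A : κ → Set ℝ, (∀ k, MeasurableSet (A k)) →
      Pairwise (fun i j => Disjoint (A i) (A j)) → (∀ k ∉ S, unif.real (A k) = β k) →
      (∀ k ∈ S, unif.real (A k) ≤ β k) → boxIntegral g A = 0 := by
  induction S using Finset.induction_on with
  | empty => exact fun A hA hd h _ => hQ A hA hd fun k => h k (Finset.notMem_empty k)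
  | insert a S ha ih =>
    intro A hA hd h1 h2
    have hUm : MeasurableSet (⋃ k ∈ Finset.univ.erase a, A k) :=
      Finset.measurableSet_biUnion _ fun k _ => hA k
    set B : Set ℝ := (⋃ k ∈ Finset.univ.erase a, A k)ᶜ with hB
    have hdB : ∀ {E}, E ⊆ B → ∀ k ≠ a, Disjoint E (A k) := by
      intro E hE k hk
      refine Set.disjoint_left.2 fun x hx hx' => hE hx ?_
      exact Set.mem_biUnion (by simpa using hk) hx'
    have hAB : A a ⊆ B := by
      intro x hx hx'
      simp only [Set.mem_iUnion] at hx'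
      obtain ⟨k, hk, hxk⟩ := hx'
      exact Set.disjoint_left.1 (hd (Finset.ne_of_mem_erase hk).symm) hx hxk
    have hle : ∀ k, unif.real (A k) ≤ β k := fun k => by
      by_cases hk : k ∈ insert a S
      · exact h2 k hk
      · exact (h1 k hk).le
    have hBm : β a < unif.real B := by
      rw [hB, probReal_compl_eq_one_sub hUm]
      have h3 := measureReal_biUnion_finset_le (μ := unif) (Finset.univ.erase a) A
      have h4 : ∑ k ∈ Finset.univ.erase a, unif.real (A k) ≤ ∑ k ∈ Finset.univ.erase a, β k :=
        Finset.sum_le_sum fun k _ => hle k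
      have h5 := Finset.add_sum_erase Finset.univ β (Finset.mem_univ a)
      linarith
    have := additive_eq_zero_of_measure_eq (B := B)
      (ν := fun E => boxIntegral g (Function.update A a E)) (C := C) hUm.compl ?_ ?_ (hβ a) hBm ?_
      (hA a) hAB
    · simpa using this
    · intro E _ _
      simpa using abs_boxIntegral_le hC (Function.update A a E) a
    · intro E E' _ _ _ hE' hdE
      exact boxIntegral_update_union hg hC hA a hE' hdE
    · intro E hEB hE hEβ
      refine ih _ (fun k => ?_) (fun i j hij => ?_) (fun k hk => ?_) fun k hk => ?_
      · rcases eq_or_ne k a with rfl | h <;> simp [*]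
      · rcases eq_or_ne i a with rfl | hi
        · simpa [hij.symm] using hdB hEB j hij.symm
        · rcases eq_or_ne j a with rfl | hj
          · simpa [hi] using (hdB hEB i hij).symm
          · simpa [hi, hj] using hd hij
      · rcases eq_or_ne k a with rfl | h
        · simpa using hEβ
        · simpa [h] using h1 k (by simp [h, hk])
      · rcases eq_or_ne k a with rfl | h
        · exact absurd hk ha
        · simpa [h] using hle k

lemma ae_ne_of_ne {k l : κ} (hkl : k ≠ l) : ∀ᵐ x ∂cube κ, x k ≠ x l := by
  classical
  have hvol : ∀ᵐ x : κ → ℝ, x k ≠ x l := by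
    set p : Submodule ℝ (κ → ℝ) :=
      LinearMap.ker (LinearMap.proj (R := ℝ) (φ := fun _ : κ => ℝ) k - LinearMap.proj l) with hp
    have h0 : volume (p : Set (κ → ℝ)) = 0 := by
      refine Measure.addHaar_submodule _ _ fun h => ?_
      have : Pi.single k (1 : ℝ) ∈ p := h ▸ Submodule.mem_top
      simp [hp, hkl.symm] at this
    rw [ae_iff]
    convert h0 using 2
    ext x
    simp [hp, sub_eq_zero]
  rw [volume_pi] at hvol
  have := ae_restrict_of_ae (s := Set.univ.pi fun _ : κ => Set.Icc (0 : ℝ) 1) hvol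
  rwa [Measure.restrict_pi_pi] at this

lemma ae_restrict_eq_zero_of_boxIntegral (hg : Measurable g) (hC : ∀ x, |g x| ≤ C)
    {b : κ → Set ℝ} (hb : ∀ k, MeasurableSet (b k))
    (h : ∀ A : κ → Set ℝ, (∀ k, MeasurableSet (A k)) → (∀ k, A k ⊆ b k) → boxIntegral g A = 0) :
    g =ᵐ[(cube κ).restrict (Set.univ.pi b)] 0 := by
  have hint : Integrable g ((cube κ).restrict (Set.univ.pi b)) := integrable_of_bounded hg hC
  refine hint.ae_eq_zero_of_forall_setIntegral_eq_zero fun s hs _ => ?_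
  have huniv : ∫ x, g x ∂(cube κ).restrict (Set.univ.pi b) = 0 := h b hb fun _ => subset_rfl
  have hgen : (MeasurableSpace.pi : MeasurableSpace (κ → ℝ)) = _ := generateFrom_pi.symm
  induction s, hs using MeasurableSpace.induction_on_inter hgen isPiSystem_pi with
  | empty => simp
  | basic s hs =>
    obtain ⟨t, ht, rfl⟩ := hs
    have ht' : ∀ k, MeasurableSet (t k) := fun k => ht k (Set.mem_univ k)
    rw [Measure.restrict_restrict (MeasurableSet.univ_pi ht'), ← Set.pi_inter_distrib]
    exact h _ (fun k => (ht' k).inter (hb k)) fun k => Set.inter_subset_right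
  | compl s hs ih =>
    have := integral_add_compl hs hint
    rw [huniv, ih (measure_lt_top _ _)] at this
    linarith
  | iUnion f hd hf ih =>
    rw [integral_iUnion hf hd hint.integrableOn]
    simp [ih _ (measure_lt_top _ _)]

lemma ae_eq_zero_of_boxIntegral_small (hg : Measurable g) (hC : ∀ x, |g x| ≤ C)
    {β : κ → ℝ} (hβ : ∀ k, 0 < β k)
    (h : ∀ A : κ → Set ℝ, (∀ k, MeasurableSet (A k)) →
      Pairwise (fun i j => Disjoint (A i) (A j)) → (∀ k, unif.real (A k) ≤ β k) →
      boxIntegral g A = 0) : g =ᵐ[cube κ] 0 := by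
  have hb : ∀ b : κ → TopologicalSpace.countableBasis ℝ,
      ∀ᵐ x ∂cube κ, Pairwise (fun i j => Disjoint (b i : Set ℝ) (b j)) →
        (∀ k, unif.real (b k) ≤ β k) → (∀ k, x k ∈ (b k : Set ℝ)) → g x = 0 := by
    intro b
    have hbm : ∀ k, MeasurableSet (b k : Set ℝ) := fun k =>
      (TopologicalSpace.isOpen_of_mem_countableBasis (b k).2).measurableSet
    by_cases hd : Pairwise (fun i j => Disjoint (b i : Set ℝ) (b j))
    · by_cases hm : ∀ k, unif.real (b k) ≤ β k
      · have := ae_restrict_eq_zero_of_boxIntegral hg hC hbm fun A hA hAb =>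
          h A hA (fun i j hij => (hd hij).mono (hAb i) (hAb j))
            fun k => (measureReal_mono (hAb k)).trans (hm k)
        rw [EventuallyEq, ae_restrict_iff' (MeasurableSet.univ_pi hbm)] at this
        filter_upwards [this] with x hx _ _ hxb
        exact hx fun k _ => hxb k
      · exact ae_of_all _ fun x _ h' => absurd h' hm
    · exact ae_of_all _ fun x h' => absurd h' hd
  have hne : ∀ᵐ x ∂cube κ, ∀ k l, k ≠ l → x k ≠ x l := by
    simp only [ae_all_iff]
    exact fun k l hkl => ae_ne_of_ne hkl
  filter_upwards [ae_all_iff.2 hb, hne] with x hx hxne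
  obtain ⟨U, hU, hUd⟩ := (Set.finite_range x).t2_separation
  have hV : ∀ k, ∃ V, x k ∈ V ∧ IsOpen V ∧ unif V < ENNReal.ofReal (β k) := fun k => by
    obtain ⟨V, hV, hVo, hVm⟩ := Set.exists_isOpen_lt_of_lt (μ := unif) {x k}
      (ENNReal.ofReal (β k)) (by simpa using hβ k)
    exact ⟨V, hV rfl, hVo, hVm⟩
  choose V hxV hVo hVm using hV
  have hbas : ∀ k, ∃ b : TopologicalSpace.countableBasis ℝ, x k ∈ (b : Set ℝ) ∧
      (b : Set ℝ) ⊆ U (x k) ∩ V k := fun k => by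
    obtain ⟨b, hb, hxb, hbs⟩ := (TopologicalSpace.isBasis_countableBasis ℝ).exists_subset_of_mem_open
      (show x k ∈ U (x k) ∩ V k from ⟨(hU _).1, hxV k⟩) ((hU _).2.inter (hVo k))
    exact ⟨⟨b, hb⟩, hxb, hbs⟩
  choose b hxb hbs using hbas
  refine hx b (fun i j hij => ?_) (fun k => ?_) hxb
  · exact (hUd ⟨i, rfl⟩ ⟨j, rfl⟩ (hxne i j hij)).mono
      ((hbs i).trans Set.inter_subset_left) ((hbs j).trans Set.inter_subset_left)
  · refine (measureReal_mono ((hbs k).trans Set.inter_subset_right)).trans ?_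
    exact ENNReal.toReal_le_of_le_ofReal (hβ k).le (hVm k).le

/-- If `g` integrates to zero over all boxes with disjoint sides of prescribed lengths of total
less than one, then `g` vanishes almost everywhere. -/
lemma ae_eq_zero_of_boxIntegral (hg : Measurable g) (hC : ∀ x, |g x| ≤ C)
    {β : κ → ℝ} (hβ : ∀ k, 0 < β k) (hsum : ∑ k, β k < 1)
    (hQ : ∀ A : κ → Set ℝ, (∀ k, MeasurableSet (A k)) →
      Pairwise (fun i j => Disjoint (A i) (A j)) → (∀ k, unif.real (A k) = β k) →
      boxIntegral g A = 0) : g =ᵐ[cube κ] 0 := by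
  classical
  exact ae_eq_zero_of_boxIntegral_small hg hC hβ fun A hA hd h =>
    boxIntegral_eq_zero_of_le hg hC hβ hsum hQ Finset.univ A hA hd
      (fun k hk => absurd (Finset.mem_univ k) hk) fun k _ => h k

end BoxIntegral

lemma measurePreserving_comp_perm {ι : Type*} [Fintype ι] (σ : Equiv.Perm ι) :
    MeasurePreserving (fun (x : ι → ℝ) k => x (σ k)) (cube ι) (cube ι) := by
  have hm : Measurable fun (x : ι → ℝ) k => x (σ k) := by fun_prop
  refine ⟨hm, (Measure.pi_eq fun s hs => ?_).symm⟩
  rw [Measure.map_apply hm (MeasurableSet.univ_pi hs)]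
  have : (fun (x : ι → ℝ) k => x (σ k)) ⁻¹' Set.univ.pi s =
      Set.univ.pi fun k => s (σ.symm k) := by
    ext x
    simp only [Set.mem_preimage, Set.mem_univ_pi]
    exact ⟨fun h k => by simpa using h (σ.symm k), fun h k => by simpa using h (σ k)⟩
  rw [this, Measure.pi_pi]
  exact Equiv.prod_comp σ.symm fun k => unif (s k)

/-- The map choosing the right copy of `k ∈ T` and the left copy of `k ∉ T`. -/
def chooseCopy {ι : Type*} [DecidableEq ι] (T : Finset ι) (k : ι) : ι ⊕ ι := if k ∈ T then Sum.inr k else Sum.inl k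

lemma elim_chooseCopy {ι : Type*} [DecidableEq ι] (T : Finset ι) (k : ι) : Sum.elim id id (chooseCopy T k) = k := by
  unfold chooseCopy; split_ifs <;> rfl

lemma boxIntegral_comp_perm {ι : Type*} [Fintype ι] {g : (ι → ℝ) → ℝ} (hg : Measurable g)
    (hsymm : ∀ (σ : Equiv.Perm ι) x, g (fun k => x (σ k)) = g x) (σ : Equiv.Perm ι)
    {A : ι → Set ℝ} (hA : ∀ k, MeasurableSet (A k)) :
    boxIntegral g (fun k => A (σ k)) = boxIntegral g A := by
  have hmp := measurePreserving_comp_perm σ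
  rw [boxIntegral, ← hmp.map_eq, setIntegral_map (MeasurableSet.univ_pi fun k => hA _)
    hg.aestronglyMeasurable hmp.measurable.aemeasurable]
  have : (fun (x : ι → ℝ) k => x (σ k)) ⁻¹' (Set.univ.pi fun k => A (σ k)) = Set.univ.pi A := by
    ext x
    simp only [Set.mem_preimage, Set.mem_univ_pi]
    exact ⟨fun h k => by simpa using h (σ.symm k), fun h k => h _⟩
  simp only [this, hsymm]
  rfl

section Symmetric

variable {ι : Type*} [Fintype ι] [DecidableEq ι] {g : (ι → ℝ) → ℝ} {C : ℝ}

lemma boxIntegral_update_comm (hg : Measurable g)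
    (hsymm : ∀ (σ : Equiv.Perm ι) x, g (fun k => x (σ k)) = g x) {i j : ι} (hij : i ≠ j)
    {A : ι → Set ℝ} (hA : ∀ k, MeasurableSet (A k)) {U V : Set ℝ} (hU : MeasurableSet U)
    (hV : MeasurableSet V) :
    boxIntegral g (Function.update (Function.update A i U) j V) =
      boxIntegral g (Function.update (Function.update A i V) j U) := by
  rw [← boxIntegral_comp_perm hg hsymm (Equiv.swap i j)
    (A := Function.update (Function.update A i V) j U)]
  · congr 1
    ext1 k
    rcases eq_or_ne k j with rfl | hkj
    · simp [hij]
    · rcases eq_or_ne k i with rfl | hki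
      · simp [hkj]
      · simp [hki, hkj, Equiv.swap_apply_of_ne_of_ne]
  · intro k
    rcases eq_or_ne k j with rfl | hkj
    · simpa
    · rcases eq_or_ne k i with rfl | hki <;> simp [*]

lemma second_difference_boxIntegral_eq_zero (hg : Measurable g) (hC : ∀ x, |g x| ≤ C)
    (hsymm : ∀ (σ : Equiv.Perm ι) x, g (fun k => x (σ k)) = g x)
    {α : ι → ℝ} (hα1 : ∑ k, α k = 1)
    (hQ : ∀ A : ι → Set ℝ, (∀ k, MeasurableSet (A k)) →
      Pairwise (fun i j => Disjoint (A i) (A j)) → (∀ k, unif.real (A k) = α k) →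
      boxIntegral g A = 0)
    {i j : ι} (hij : i ≠ j) {ε : ℝ} (hεi : 2 * ε ≤ α i) (hεj : 2 * ε ≤ α j)
    {Z : ι ⊕ ι → Set ℝ} (hZ : ∀ c, MeasurableSet (Z c))
    (hZd : Pairwise (fun c d => Disjoint (Z c) (Z d)))
    (T : Finset ι) (hZα : ∀ k, k ≠ i → k ≠ j → unif.real (Z (chooseCopy T k)) = α k)
    (hZε : ∀ c, Sum.elim id id c = i ∨ Sum.elim id id c = j → unif.real (Z c) = ε) :
    let N := fun U V => boxIntegral g
      (Function.update (Function.update (fun k => Z (chooseCopy T k)) i U) j V)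
    N (Z (.inr i)) (Z (.inr j)) - N (Z (.inr i)) (Z (.inl j)) - N (Z (.inl i)) (Z (.inr j))
      + N (Z (.inl i)) (Z (.inl j)) = 0 := by
  intro N
  set A : ι → Set ℝ := fun k => Z (chooseCopy T k) with hAdef
  have hA : ∀ k, MeasurableSet (A k) := fun k => hZ _
  have hAi : ∀ {U}, MeasurableSet U → ∀ k, MeasurableSet (Function.update A i U k) := by
    intro U hU k
    rcases eq_or_ne k i with rfl | hk <;> simp [*]
  have hcomm : ∀ {U V}, MeasurableSet U → MeasurableSet V → N U V = N V U :=
    fun hU hV => boxIntegral_update_comm hg hsymm hij hA hU hV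
  have haddr : ∀ {U V V'}, MeasurableSet U → MeasurableSet V' → Disjoint V V' →
      N U (V ∪ V') = N U V + N U V' := fun hU hV' hd =>
    boxIntegral_update_union hg hC (hAi hU) j hV' hd
  have haddl : ∀ {U U' V}, MeasurableSet U → MeasurableSet U' → MeasurableSet V →
      Disjoint U U' → N (U ∪ U') V = N U V + N U' V := fun hU hU' hV hd => by
    rw [hcomm (hU.union hU') hV, haddr hV hU' hd, hcomm hV hU, hcomm hV hU']
  -- the part of the line not used by the small sets and the remaining coordinates
  set K : Finset ι := (Finset.univ.erase i).erase j with hK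
  set Sp : Finset (ι ⊕ ι) := {.inl i, .inr i, .inl j, .inr j} with hSp
  set I : Finset (ι ⊕ ι) := K.image (chooseCopy T) ∪ Sp with hI
  have hmemK : ∀ k, k ∈ K ↔ k ≠ i ∧ k ≠ j := fun k => by simp [hK, and_comm]
  have hmemSp : ∀ c, c ∈ Sp ↔ Sum.elim id id c = i ∨ Sum.elim id id c = j := by
    rintro (c | c) <;> simp [hSp]
  set R : Set ℝ := (⋃ c ∈ I, Z c)ᶜ with hR
  have hUm : MeasurableSet (⋃ c ∈ I, Z c) := Finset.measurableSet_biUnion _ fun c _ => hZ c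
  have hcardSp : ∑ c ∈ Sp, unif.real (Z c) = 4 * ε := by
    rw [Finset.sum_congr rfl fun c hc => hZε c ((hmemSp c).1 hc), Finset.sum_const, nsmul_eq_mul]
    congr 1
    have : Sp.card = 4 := by simp [hSp, hij, Finset.card_insert_of_notMem]
    rw [this]; norm_num
  have hsumK : ∑ k ∈ K, α k = 1 - α i - α j := by
    have h1 := Finset.add_sum_erase Finset.univ α (Finset.mem_univ i)
    have h2 := Finset.add_sum_erase (Finset.univ.erase i) α (a := j) (by simp [hij.symm])
    linarith
  have hRm : α i + α j - 4 * ε ≤ unif.real R := by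
    rw [hR, probReal_compl_eq_one_sub hUm]
    have h1 := measureReal_biUnion_finset_le (μ := unif) I Z
    have h2 : ∑ c ∈ I, unif.real (Z c) ≤
        ∑ c ∈ K.image (chooseCopy T), unif.real (Z c) + ∑ c ∈ Sp, unif.real (Z c) := by
      rw [← Finset.sum_union_inter]
      exact le_add_of_nonneg_right (Finset.sum_nonneg fun _ _ => measureReal_nonneg)
    have h3 : ∑ c ∈ K.image (chooseCopy T), unif.real (Z c) = ∑ k ∈ K, α k := by
      rw [Finset.sum_image]
      · exact Finset.sum_congr rfl fun k hk => hZα k ((hmemK k).1 hk).1 ((hmemK k).1 hk).2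
      · intro k _ l _ hkl
        rw [← elim_chooseCopy T k, hkl, elim_chooseCopy]
    linarith
  have hRZ : ∀ {D}, D ⊆ R → ∀ c ∈ I, Disjoint D (Z c) := fun hD c hc =>
    Set.disjoint_left.2 fun x hx hx' => hD hx (Set.mem_biUnion hc hx')
  obtain ⟨D, hDR, hD, hDm⟩ := exists_subset_unif_eq hUm.compl (t := α i - 2 * ε) (by linarith)
    (by linarith)
  obtain ⟨D', hDR', hD', hDm'⟩ := exists_subset_unif_eq (hUm.compl.diff hD) (t := α j - 2 * ε)
    (by linarith) (by rw [measureReal_sdiff hDR hD]; linarith)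
  have hDD' : Disjoint D D' := Set.disjoint_left.2 fun x hx hx' => (hDR' hx').2 hx
  replace hDR' := hDR'.trans Set.sdiff_subset
  have hSpI : ∀ {c}, c ∈ Sp → c ∈ I := fun hc => Finset.mem_union_right _ hc
  have hKI : ∀ {k}, k ∈ K → chooseCopy T k ∈ I := fun hk =>
    Finset.mem_union_left _ (Finset.mem_image_of_mem _ hk)
  have hSpK : ∀ {c k}, c ∈ Sp → k ∈ K → Disjoint (Z c) (A k) := fun {c k} hc hk => by
    refine hZd fun h => ?_
    have h1 := (hmemSp c).1 hc
    rw [h, elim_chooseCopy] at h1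
    exact h1.elim ((hmemK k).1 hk).1 ((hmemK k).1 hk).2
  have hconf : ∀ p q p' q', p ∈ Sp → q ∈ Sp → p' ∈ Sp → q' ∈ Sp → p ≠ q → p' ≠ q' →
      p ≠ p' → p ≠ q' → q ≠ p' → q ≠ q' →
      N D D' + N D (Z p') + N D (Z q') + (N (Z p) D' + N (Z p) (Z p') + N (Z p) (Z q'))
        + (N (Z q) D' + N (Z q) (Z p') + N (Z q) (Z q')) = 0 := by
    intro p q p' q' hp hq hp' hq' hpq hpq' hpp' hpq'' hqp' hqq'
    have hU : MeasurableSet (D ∪ (Z p ∪ Z q)) := hD.union ((hZ p).union (hZ q))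
    have hV : MeasurableSet (D' ∪ (Z p' ∪ Z q')) := hD'.union ((hZ p').union (hZ q'))
    have hdU : Disjoint D (Z p ∪ Z q) := (hRZ hDR p (hSpI hp)).union_right (hRZ hDR q (hSpI hq))
    have hdV : Disjoint D' (Z p' ∪ Z q') :=
      (hRZ hDR' p' (hSpI hp')).union_right (hRZ hDR' q' (hSpI hq'))
    have hUV : Disjoint (D ∪ (Z p ∪ Z q)) (D' ∪ (Z p' ∪ Z q')) := by
      simp only [Set.disjoint_union_left, Set.disjoint_union_right]
      exact ⟨⟨hDD', (hRZ hDR' p (hSpI hp)).symm, (hRZ hDR' q (hSpI hq)).symm⟩,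
        ⟨hRZ hDR p' (hSpI hp'), hZd hpp', hZd hqp'⟩,
        hRZ hDR q' (hSpI hq'), hZd hpq'', hZd hqq'⟩
    have hUK : ∀ k ∈ K, Disjoint (D ∪ (Z p ∪ Z q)) (A k) := fun k hk => by
      simp only [Set.disjoint_union_left]
      exact ⟨hRZ hDR _ (hKI hk), hSpK hp hk, hSpK hq hk⟩
    have hVK : ∀ k ∈ K, Disjoint (D' ∪ (Z p' ∪ Z q')) (A k) := fun k hk => by
      simp only [Set.disjoint_union_left]
      exact ⟨hRZ hDR' _ (hKI hk), hSpK hp' hk, hSpK hq' hk⟩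
    have hzero : N (D ∪ (Z p ∪ Z q)) (D' ∪ (Z p' ∪ Z q')) = 0 := by
      refine hQ _ (fun k => ?_) (fun k l hkl => ?_) fun k => ?_
      · rcases eq_or_ne k j with rfl | hkj
        · simpa using hV
        · simpa [hkj] using hAi hU k
      · rcases eq_or_ne k j with rfl | hkj
        · rcases eq_or_ne l i with rfl | hli
          · simpa [hkl.symm] using hUV.symm
          · simpa [hkl.symm, hli] using hVK l ((hmemK l).2 ⟨hli, hkl.symm⟩)
        · rcases eq_or_ne k i with rfl | hki
          · rcases eq_or_ne l j with rfl | hlj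
            · simpa [hkl] using hUV
            · simpa [hkj, hlj, hkl.symm] using hUK l ((hmemK l).2 ⟨hkl.symm, hlj⟩)
          · rcases eq_or_ne l j with rfl | hlj
            · simpa [hki, hkj] using (hVK k ((hmemK k).2 ⟨hki, hkj⟩)).symm
            · rcases eq_or_ne l i with rfl | hli
              · simpa [hki, hkj, hlj] using (hUK k ((hmemK k).2 ⟨hki, hkj⟩)).symm
              · simp only [Function.update_of_ne hkj, Function.update_of_ne hki,
                  Function.update_of_ne hlj, Function.update_of_ne hli]
                refine hZd fun h => hkl ?_
                rw [← elim_chooseCopy T k, h, elim_chooseCopy]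
      · rcases eq_or_ne k j with rfl | hkj
        · rw [Function.update_self, measureReal_union hdV ((hZ p').union (hZ q')),
            measureReal_union (hZd hpq') (hZ q'), hZε p' ((hmemSp _).1 hp'),
            hZε q' ((hmemSp _).1 hq'), hDm']
          ring
        · rcases eq_or_ne k i with rfl | hki
          · rw [Function.update_of_ne hkj, Function.update_self,
              measureReal_union hdU ((hZ p).union (hZ q)),
              measureReal_union (hZd hpq) (hZ q), hZε p ((hmemSp _).1 hp),
              hZε q ((hmemSp _).1 hq), hDm]
            ring
          · rw [Function.update_of_ne hkj, Function.update_of_ne hki]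
            exact hZα k hki hkj
    rw [haddl hD ((hZ p).union (hZ q)) hV hdU, haddl (hZ p) (hZ q) hV (hZd hpq),
      haddr hD ((hZ p').union (hZ q')) hdV, haddr hD (hZ q') (hZd hpq'),
      haddr (hZ p) ((hZ p').union (hZ q')) hdV, haddr (hZ p) (hZ q') (hZd hpq'),
      haddr (hZ q) ((hZ p').union (hZ q')) hdV, haddr (hZ q) (hZ q') (hZd hpq')] at hzero
    linarith
  have c1 := hconf (.inr i) (.inr j) (.inl i) (.inl j) (by simp [hSp]) (by simp [hSp])
    (by simp [hSp]) (by simp [hSp]) (by simp [hij]) (by simp [hij]) (by simp) (by simp) (by simp)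
    (by simp)
  have c2 := hconf (.inr i) (.inl j) (.inl i) (.inr j) (by simp [hSp]) (by simp [hSp])
    (by simp [hSp]) (by simp [hSp]) (by simp) (by simp) (by simp) (by simp [hij])
    (by simp [hij.symm]) (by simp)
  have c3 := hconf (.inl i) (.inr j) (.inr i) (.inl j) (by simp [hSp]) (by simp [hSp])
    (by simp [hSp]) (by simp [hSp]) (by simp) (by simp) (by simp) (by simp [hij])
    (by simp [hij.symm]) (by simp)
  have c4 := hconf (.inl i) (.inl j) (.inr i) (.inr j) (by simp [hSp]) (by simp [hSp])
    (by simp [hSp]) (by simp [hSp]) (by simp [hij]) (by simp [hij]) (by simp) (by simp) (by simp)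
    (by simp)
  have s := fun c d => hcomm (hZ c) (hZ d)
  linarith [s (.inr i) (.inl i), s (.inr i) (.inl j), s (.inr i) (.inr j), s (.inl i) (.inl j),
    s (.inl i) (.inr j), s (.inr j) (.inl j)]

end Symmetric

section Copies

variable {ι : Type*} [Fintype ι] [DecidableEq ι] {g : (ι → ℝ) → ℝ} {C : ℝ}

lemma map_chooseCopy_pi (T : Finset ι) (ν : ι ⊕ ι → Measure ℝ) [∀ c, IsFiniteMeasure (ν c)]
    (hν : ∀ c, ν c Set.univ ≠ 0) :
    (Measure.pi ν).map (fun z k => z (chooseCopy T k)) =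
      (∏ k, ν (chooseCopy Tᶜ k) Set.univ) • Measure.pi fun k => ν (chooseCopy T k) := by
  set c : ENNReal := ∏ k, ν (chooseCopy Tᶜ k) Set.univ with hc
  have hc0 : c ≠ 0 := Finset.prod_ne_zero_iff.2 fun k _ => hν _
  have hct : c ≠ ⊤ := ENNReal.prod_ne_top fun k _ => measure_ne_top _ _
  have hm : Measurable fun (z : ι ⊕ ι → ℝ) k => z (chooseCopy T k) := by fun_prop
  have key : Measure.pi (fun k => ν (chooseCopy T k)) =
      c⁻¹ • (Measure.pi ν).map (fun z k => z (chooseCopy T k)) := by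
    refine Measure.pi_eq fun s hs => ?_
    rw [Measure.smul_apply, Measure.map_apply hm (MeasurableSet.univ_pi hs)]
    have : (fun (z : ι ⊕ ι → ℝ) k => z (chooseCopy T k)) ⁻¹' Set.univ.pi s =
        Set.univ.pi (Sum.elim (fun k => if k ∈ T then Set.univ else s k)
          fun k => if k ∈ T then s k else Set.univ) := by
      ext z
      simp only [Set.mem_preimage, Set.mem_univ_pi, Sum.forall, Sum.elim_inl, Sum.elim_inr,
        ← forall_and]
      refine forall_congr' fun k => ?_
      by_cases hk : k ∈ T <;> simp [chooseCopy, hk]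
    rw [this, Measure.pi_pi, Fintype.prod_sum_type, ← Finset.prod_mul_distrib,
      Finset.prod_congr rfl (g := fun k => ν (chooseCopy Tᶜ k) Set.univ *
        ν (chooseCopy T k) (s k)), Finset.prod_mul_distrib, ← hc, smul_eq_mul, ← mul_assoc,
      ENNReal.inv_mul_cancel hc0 hct, one_mul]
    intro k _
    by_cases hk : k ∈ T <;> simp [chooseCopy, hk, mul_comm]
  rw [key, smul_smul, ENNReal.mul_inv_cancel hc0 hct, one_smul]

lemma boxIntegral_comp_chooseCopy (hg : Measurable g) (T : Finset ι) {Z : ι ⊕ ι → Set ℝ}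
    (hZ0 : ∀ c, unif.real (Z c) ≠ 0) :
    boxIntegral (fun z => g (fun k => z (chooseCopy T k))) Z =
      (∏ k, unif.real (Z (chooseCopy Tᶜ k))) * boxIntegral g (fun k => Z (chooseCopy T k)) := by
  have hm : Measurable fun (z : ι ⊕ ι → ℝ) k => z (chooseCopy T k) := by fun_prop
  rw [boxIntegral, boxIntegral, Measure.restrict_pi_pi, Measure.restrict_pi_pi,
    ← integral_map (f := g) hm.aemeasurable hg.aestronglyMeasurable, map_chooseCopy_pi,
    integral_smul_measure, ENNReal.toReal_prod, smul_eq_mul]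
  · simp [Measure.real]
  · intro c h
    apply hZ0 c
    rw [Measure.restrict_apply_univ] at h
    simp [Measure.real, h]

lemma second_difference_ae_eq_zero (hg : Measurable g) (hC : ∀ x, |g x| ≤ C)
    (hsymm : ∀ (σ : Equiv.Perm ι) x, g (fun k => x (σ k)) = g x)
    {α : ι → ℝ} (hα : ∀ k, 0 < α k) (hα1 : ∑ k, α k = 1)
    (hQ : ∀ A : ι → Set ℝ, (∀ k, MeasurableSet (A k)) →
      Pairwise (fun i j => Disjoint (A i) (A j)) → (∀ k, unif.real (A k) = α k) →
      boxIntegral g A = 0)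
    {i j : ι} (hij : i ≠ j) {T : Finset ι} (hi : i ∉ T) (hj : j ∉ T) :
    ∀ᵐ z ∂cube (ι ⊕ ι), g (fun k => z (chooseCopy (insert i (insert j T)) k))
      - g (fun k => z (chooseCopy (insert i T) k)) - g (fun k => z (chooseCopy (insert j T) k))
      + g (fun k => z (chooseCopy T k)) = 0 := by
  have hgm : ∀ S : Finset ι, Measurable fun z : ι ⊕ ι → ℝ => g fun k => z (chooseCopy S k) :=
    fun S => hg.comp (by fun_prop)
  have hm1 : (1 : ℝ) ≤ Fintype.card ι := by
    exact_mod_cast Fintype.card_pos_iff.2 ⟨i⟩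
  set ε : ℝ := min (α i) (α j) / (2 * Fintype.card ι) with hε
  have hmin : 0 < min (α i) (α j) := lt_min (hα i) (hα j)
  have hε0 : 0 < ε := by positivity
  have hmε : Fintype.card ι * (2 * ε) = min (α i) (α j) := by rw [hε]; field_simp
  have h2ε : 2 * ε ≤ min (α i) (α j) := by nlinarith
  set β : ι ⊕ ι → ℝ := fun c => if Sum.elim id id c = i ∨ Sum.elim id id c = j then ε else
    if c = chooseCopy T (Sum.elim id id c) then α (Sum.elim id id c) else ε with hβ
  refine ae_eq_zero_of_boxIntegral (C := C + C + C + C)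
    ((((hgm _).sub (hgm _)).sub (hgm _)).add (hgm _)) (fun z => ?_) (β := β) (fun c => ?_) ?_
    fun Z hZ hZd hZβ => ?_
  · refine (abs_add_le _ _).trans (add_le_add ((abs_sub _ _).trans (add_le_add
      ((abs_sub _ _).trans (add_le_add ?_ ?_)) ?_)) ?_) <;> exact hC _
  · simp only [hβ]
    split_ifs
    exacts [hε0, hα _, hε0]
  · have hle : ∀ k, β (.inl k) + β (.inr k) ≤
        2 * ε + α k - (if k = i then α i else 0) - (if k = j then α j else 0) := by
      intro k
      rcases eq_or_ne k i with rfl | hki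
      · simp [hβ, hij]; linarith
      · rcases eq_or_ne k j with rfl | hkj
        · simp [hβ, hki]; linarith
        · by_cases hk : k ∈ T <;> simp [hβ, hki, hkj, chooseCopy, hk] <;> linarith
    rw [Fintype.sum_sum_type, ← Finset.sum_add_distrib]
    refine (Finset.sum_le_sum fun k _ => hle k).trans_lt ?_
    rw [Finset.sum_sub_distrib, Finset.sum_sub_distrib, Finset.sum_add_distrib, hα1]
    simp only [Finset.sum_const, Finset.card_univ, nsmul_eq_mul, Finset.sum_ite_eq',
      Finset.mem_univ, if_true]
    linarith [min_le_left (α i) (α j), hα j]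
  · have hZ0 : ∀ c, unif.real (Z c) ≠ 0 := fun c => by
      rw [hZβ]; simp only [hβ]; split_ifs
      exacts [hε0.ne', (hα _).ne', hε0.ne']
    have hZε : ∀ c, Sum.elim id id c = i ∨ Sum.elim id id c = j → unif.real (Z c) = ε :=
      fun c hc => by rw [hZβ]; simp only [hβ, if_pos hc]
    have hbox : ∀ S : Finset ι, (∀ k, k ≠ i → k ≠ j → (k ∈ S ↔ k ∈ T)) →
        boxIntegral (fun z => g (fun k => z (chooseCopy S k))) Z =
          (∏ k, unif.real (Z (chooseCopy Tᶜ k))) *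
            boxIntegral g (fun k => Z (chooseCopy S k)) := by
      intro S hS
      rw [boxIntegral_comp_chooseCopy hg S hZ0]
      congr 1
      refine Finset.prod_congr rfl fun k _ => ?_
      by_cases hk : k = i ∨ k = j
      · rw [hZε _ (by rwa [elim_chooseCopy]), hZε _ (by rwa [elim_chooseCopy])]
      · rw [not_or] at hk
        simp only [chooseCopy, Finset.mem_compl, hS k hk.1 hk.2]
    have key := second_difference_boxIntegral_eq_zero hg hC hsymm hα1 hQ hij
      (h2ε.trans (min_le_left _ _)) (h2ε.trans (min_le_right _ _)) hZ hZd T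
      (fun k hki hkj => by rw [hZβ]; simp [hβ, elim_chooseCopy, hki, hkj]) hZε
    have hupd : ∀ S : Finset ι, (∀ k, k ≠ i → k ≠ j → (k ∈ S ↔ k ∈ T)) →
        (fun k => Z (chooseCopy S k)) = Function.update (Function.update
          (fun k => Z (chooseCopy T k)) i (Z (chooseCopy S i))) j (Z (chooseCopy S j)) := by
      intro S hS
      ext1 k
      rcases eq_or_ne k j with rfl | hkj
      · simp
      · rcases eq_or_ne k i with rfl | hki
        · simp [hkj]
        · simp [hki, hkj, chooseCopy, hS k hki hkj]
    have e1 : ∀ k, k ≠ i → k ≠ j → (k ∈ insert i (insert j T) ↔ k ∈ T) :=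
      fun k h h' => by simp [h, h']
    have e2 : ∀ k, k ≠ i → k ≠ j → (k ∈ insert i T ↔ k ∈ T) := fun k h h' => by simp [h]
    have e3 : ∀ k, k ≠ i → k ≠ j → (k ∈ insert j T ↔ k ∈ T) := fun k h h' => by simp [h']
    have e4 : ∀ k, k ≠ i → k ≠ j → (k ∈ T ↔ k ∈ T) := fun k h h' => Iff.rfl
    have hint : ∀ S : Finset ι, Integrable (fun z => g fun k => z (chooseCopy S k))
        ((cube (ι ⊕ ι)).restrict (Set.univ.pi Z)) := fun S =>
      integrable_of_bounded (hgm S) fun z => hC _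
    have hlin : boxIntegral (fun z => g (fun k => z (chooseCopy (insert i (insert j T)) k))
        - g (fun k => z (chooseCopy (insert i T) k)) - g (fun k => z (chooseCopy (insert j T) k))
        + g (fun k => z (chooseCopy T k))) Z =
        boxIntegral (fun z => g (fun k => z (chooseCopy (insert i (insert j T)) k))) Z
        - boxIntegral (fun z => g (fun k => z (chooseCopy (insert i T) k))) Z
        - boxIntegral (fun z => g (fun k => z (chooseCopy (insert j T) k))) Z
        + boxIntegral (fun z => g (fun k => z (chooseCopy T k))) Z := by
      exact (integral_add (((hint _).sub (hint _)).sub (hint _)) (hint _)).trans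
        (congrArg (· + _) ((integral_sub ((hint _).sub (hint _)) (hint _)).trans
          (congrArg (· - _) (integral_sub (hint _) (hint _)))))
    refine hlin.trans ?_
    rw [hbox _ e1, hbox _ e2, hbox _ e3, hbox _ e4, hupd _ e1, hupd _ e2, hupd _ e3]
    have hT := congrArg (boxIntegral g) (hupd T e4)
    have c1 : chooseCopy (insert i (insert j T)) i = .inr i := by simp [chooseCopy]
    have c2 : chooseCopy (insert i (insert j T)) j = .inr j := by simp [chooseCopy]
    have c3 : chooseCopy (insert i T) i = .inr i := by simp [chooseCopy]
    have c4 : chooseCopy (insert i T) j = .inl j := by simp [chooseCopy, hij.symm, hj]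
    have c5 : chooseCopy (insert j T) i = .inl i := by simp [chooseCopy, hij, hi]
    have c6 : chooseCopy (insert j T) j = .inr j := by simp [chooseCopy]
    have c7 : chooseCopy T i = .inl i := by simp [chooseCopy, hi]
    have c8 : chooseCopy T j = .inl j := by simp [chooseCopy, hj]
    simp only [c1, c2, c3, c4, c5, c6, c7, c8] at hT ⊢
    dsimp only at key
    rw [← hT] at key
    rw [← mul_sub, ← mul_sub, ← mul_add, key, mul_zero]

end Copies

lemma eq_add_sum_of_second_difference {ι : Type*} [DecidableEq ι] {G : Finset ι → ℝ}
    (h : ∀ (T : Finset ι) (i j : ι), i ≠ j → i ∉ T → j ∉ T →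
      G (insert i (insert j T)) - G (insert i T) - G (insert j T) + G T = 0) (S : Finset ι) :
    G S = G ∅ + ∑ i ∈ S, (G {i} - G ∅) := by
  have h1 : ∀ (i : ι) (T : Finset ι), i ∉ T → G (insert i T) - G T = G {i} - G ∅ := by
    intro i T
    induction T using Finset.induction_on with
    | empty => intro _; simp
    | insert j T hj ih =>
      intro hi
      rw [Finset.mem_insert, not_or] at hi
      linarith [h T i j hi.1 hi.2 hj, ih hi.2]
  induction S using Finset.induction_on with
  | empty => simp
  | insert i S hi ih =>
    rw [Finset.sum_insert hi]
    linarith [h1 i S hi]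

lemma exists_ae_eq_sum {ι : Type*} [Fintype ι] [DecidableEq ι] [Nonempty ι] {g : (ι → ℝ) → ℝ}
    {C : ℝ} (hg : Measurable g) (hC : ∀ x, |g x| ≤ C)
    (hsymm : ∀ (σ : Equiv.Perm ι) x, g (fun k => x (σ k)) = g x)
    {α : ι → ℝ} (hα : ∀ k, 0 < α k) (hα1 : ∑ k, α k = 1)
    (hQ : ∀ A : ι → Set ℝ, (∀ k, MeasurableSet (A k)) →
      Pairwise (fun i j => Disjoint (A i) (A j)) → (∀ k, unif.real (A k) = α k) →
      boxIntegral g A = 0) :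
    ∃ (H : ι → ℝ → ℝ) (D : ℝ), (∀ i, Measurable (H i)) ∧ (∀ i t, |H i t| ≤ D) ∧
      g =ᵐ[cube ι] fun x => ∑ i, H i (x i) := by
  have hz : ∀ᵐ z ∂cube (ι ⊕ ι), ∀ (T : Finset ι) (i j : ι), i ≠ j → i ∉ T → j ∉ T →
      g (fun k => z (chooseCopy (insert i (insert j T)) k))
      - g (fun k => z (chooseCopy (insert i T) k)) - g (fun k => z (chooseCopy (insert j T) k))
      + g (fun k => z (chooseCopy T k)) = 0 := by
    simp only [ae_all_iff]
    intro T i j hij hi hj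
    exact second_difference_ae_eq_zero hg hC hsymm hα hα1 hQ hij hi hj
  have hz' := (measurePreserving_sumPiEquivProdPi_symm
    (fun _ : ι ⊕ ι => unif)).quasiMeasurePreserving.ae hz
  obtain ⟨y, hy⟩ := (Measure.ae_ae_of_ae_prod hz').exists
  refine ⟨fun i t => g (Function.update y i t) - g y + g y / Fintype.card ι,
    C + C + C, fun i => ?_, fun i t => ?_, ?_⟩
  · exact ((hg.comp (measurable_update y)).sub_const _).add_const _
  · refine (abs_add_le _ _).trans (add_le_add ((abs_sub _ _).trans
      (add_le_add (hC _) (hC _))) ?_)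
    rw [abs_div, Nat.abs_cast]
    exact (div_le_self (abs_nonneg _) (by exact_mod_cast Fintype.card_pos)).trans (hC y)
  · filter_upwards [hy] with x hx
    have key := eq_add_sum_of_second_difference (G := fun T => g fun k =>
      (MeasurableEquiv.sumPiEquivProdPi fun _ : ι ⊕ ι => ℝ).symm (y, x) (chooseCopy T k))
      hx Finset.univ
    have e0 : (fun k => (MeasurableEquiv.sumPiEquivProdPi fun _ : ι ⊕ ι => ℝ).symm (y, x)
        (chooseCopy ∅ k)) = y := by
      ext k
      simp [chooseCopy, MeasurableEquiv.sumPiEquivProdPi, Equiv.sumPiEquivProdPi]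
    have e1 : (fun k => (MeasurableEquiv.sumPiEquivProdPi fun _ : ι ⊕ ι => ℝ).symm (y, x)
        (chooseCopy Finset.univ k)) = x := by
      ext k
      simp [chooseCopy, MeasurableEquiv.sumPiEquivProdPi, Equiv.sumPiEquivProdPi]
    have e2 : ∀ i, (fun k => (MeasurableEquiv.sumPiEquivProdPi fun _ : ι ⊕ ι => ℝ).symm (y, x)
        (chooseCopy {i} k)) = Function.update y i (x i) := by
      intro i
      ext k
      rcases eq_or_ne k i with rfl | hk <;>
        simp [chooseCopy, MeasurableEquiv.sumPiEquivProdPi, Equiv.sumPiEquivProdPi, *]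
    simp only [e0, e1, e2] at key
    rw [key, Finset.sum_add_distrib, Finset.sum_const, Finset.card_univ, nsmul_eq_mul,
      mul_div_cancel₀ _ (by simp), add_comm]

lemma exists_ae_eq_sum_same {m : ℕ} [NeZero m] {g : (Fin m → ℝ) → ℝ} {C : ℝ}
    (hg : Measurable g) (hC : ∀ x, |g x| ≤ C)
    (hsymm : ∀ (σ : Equiv.Perm (Fin m)) x, g (fun k => x (σ k)) = g x)
    {α : Fin m → ℝ} (hα : ∀ k, 0 < α k) (hα1 : ∑ k, α k = 1)
    (hQ : ∀ A : Fin m → Set ℝ, (∀ k, MeasurableSet (A k)) →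
      Pairwise (fun i j => Disjoint (A i) (A j)) → (∀ k, unif.real (A k) = α k) →
      boxIntegral g A = 0) :
    ∃ (h : ℝ → ℝ) (D : ℝ), Measurable h ∧ (∀ t, |h t| ≤ D) ∧
      g =ᵐ[cube (Fin m)] fun x => ∑ i, h (x i) := by
  obtain ⟨H, D, hH, hD, hgH⟩ := exists_ae_eq_sum hg hC hsymm hα hα1 hQ
  have hm0 : (m : ℝ) ≠ 0 := NeZero.ne _
  refine ⟨fun t => (m : ℝ)⁻¹ * ∑ i, H i t, D, ?_, fun t => ?_, ?_⟩
  · exact (Finset.measurable_sum _ fun i _ => hH i).const_mul _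
  · rw [abs_mul, abs_inv, Nat.abs_cast, inv_mul_le_iff₀ (by positivity)]
    refine (Finset.abs_sum_le_sum_abs _ _).trans ((Finset.sum_le_sum fun i _ => hD i t).trans ?_)
    simp
  · have hk : ∀ᵐ x ∂cube (Fin m), ∀ k, g x = ∑ i, H i (x (i + k)) := by
      refine ae_all_iff.2 fun k => ?_
      filter_upwards [(measurePreserving_comp_perm (Equiv.addRight k)).quasiMeasurePreserving.ae
        hgH] with x hx
      rw [hsymm] at hx
      exact hx
    filter_upwards [hk] with x hx
    have hs : ∑ k : Fin m, g x = ∑ j, ∑ i, H i (x j) := by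
      rw [Finset.sum_congr rfl fun k _ => hx k, Finset.sum_comm]
      conv_rhs => rw [Finset.sum_comm]
      refine Finset.sum_congr rfl fun i _ => ?_
      exact Equiv.sum_comp (Equiv.addLeft i) fun j => H i (x j)
    rw [Finset.sum_const, Finset.card_univ, Fintype.card_fin, nsmul_eq_mul] at hs
    rw [← Finset.mul_sum, ← hs, inv_mul_cancel_left₀ hm0]

section BoxIntegralFormulas

variable {ι : Type*} [Fintype ι]

lemma boxIntegral_congr_ae {g g' : (ι → ℝ) → ℝ} (h : g =ᵐ[cube ι] g') (A : ι → Set ℝ) :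
    boxIntegral g A = boxIntegral g' A :=
  integral_congr_ae (ae_restrict_of_ae h)

lemma boxIntegral_const (c : ℝ) (A : ι → Set ℝ) :
    boxIntegral (fun _ => c) A = (∏ k, unif.real (A k)) * c := by
  rw [boxIntegral, setIntegral_const, Measure.real, Measure.pi_pi, ENNReal.toReal_prod, smul_eq_mul]
  rfl

lemma boxIntegral_sum [DecidableEq ι] {h : ℝ → ℝ} (hh : Integrable h unif) (A : ι → Set ℝ) :
    boxIntegral (fun x => ∑ i, h (x i)) A =
      ∑ i, (∏ k ∈ Finset.univ.erase i, unif.real (A k)) * ∫ t in A i, h t ∂unif := by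
  rw [boxIntegral, Measure.restrict_pi_pi,
    integral_finsetSum _ fun i _ => integrable_comp_eval hh.restrict]
  refine Finset.sum_congr rfl fun i _ => ?_
  have hmap := Measure.pi_map_eval (fun k => unif.restrict (A k)) i
  have hct : (∏ j ∈ Finset.univ.erase i, (unif.restrict (A j)) Set.univ) ≠ ⊤ :=
    ENNReal.prod_ne_top fun k _ => measure_ne_top _ _
  have hmeas : AEStronglyMeasurable h
      ((Measure.pi fun k => unif.restrict (A k)).map (Function.eval i)) := by
    rw [hmap]
    exact (hh.restrict.smul_measure hct).aestronglyMeasurable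
  have hev : Measurable (Function.eval i : (ι → ℝ) → ℝ) := measurable_pi_apply i
  have := integral_map hev.aemeasurable hmeas
  refine this.symm.trans ?_
  rw [hmap, integral_smul_measure, ENNReal.toReal_prod, smul_eq_mul]
  simp [Measure.real]

end BoxIntegralFormulas

section UnequalSides

variable {ι : Type*} [Fintype ι] [DecidableEq ι] {α : ι → ℝ} {h : ℝ → ℝ}

lemma setIntegral_eq_of_boxIntegral_sum_eq_zero (hα : ∀ k, 0 < α k) (hα1 : ∑ k, α k = 1)
    (hh : Integrable h unif)
    (hQ : ∀ A : ι → Set ℝ, (∀ k, MeasurableSet (A k)) →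
      Pairwise (fun i j => Disjoint (A i) (A j)) → (∀ k, unif.real (A k) = α k) →
      boxIntegral (fun x => ∑ i, h (x i)) A = 0) {i j : ι} (hij : α i ≠ α j) {E E' : Set ℝ}
    (hE : MeasurableSet E) (hE' : MeasurableSet E') (hd : Disjoint E E')
    (heq : unif.real E = unif.real E') (hle : unif.real E ≤ min (α i) (α j)) :
    ∫ t in E, h t ∂unif = ∫ t in E', h t ∂unif := by
  have hne : i ≠ j := fun h => hij (h ▸ rfl)
  set t := unif.real E with ht
  obtain ⟨A, hA, hAR, hAd, hAγ, -⟩ := exists_disjoint_family Finset.univ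
    (fun k => α k - (if k = i then t else 0) - (if k = j then t else 0)) (fun k _ => by
      rcases eq_or_ne k i with rfl | hki
      · simpa [hne] using hle.trans (min_le_left _ _)
      · rcases eq_or_ne k j with rfl | hkj
        · simpa [hki] using hle.trans (min_le_right _ _)
        · simpa [hki, hkj] using (hα k).le) (hE.union hE').compl (by
      rw [probReal_compl_eq_one_sub (hE.union hE'), measureReal_union hd hE', ← heq]
      simp only [Finset.sum_sub_distrib, hα1, Finset.sum_ite_eq', Finset.mem_univ, if_true]
      linarith)
  have key : ∀ U V : Set ℝ, MeasurableSet U → MeasurableSet V → Disjoint U V →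
      U ⊆ E ∪ E' → V ⊆ E ∪ E' → unif.real U = t → unif.real V = t →
      (∑ k, (∏ l ∈ Finset.univ.erase k, α l) * ∫ t in A k, h t ∂unif)
        + (∏ l ∈ Finset.univ.erase i, α l) * (∫ t in U, h t ∂unif)
        + (∏ l ∈ Finset.univ.erase j, α l) * (∫ t in V, h t ∂unif) = 0 := by
    intro U V hU hV hUV hUE hVE hUt hVt
    set X : ι → Set ℝ := fun k => if k = i then U else if k = j then V else ∅ with hX
    have hXm : ∀ k, MeasurableSet (X k) := fun k => by
      simp only [hX]; split_ifs
      exacts [hU, hV, MeasurableSet.empty]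
    have hXE : ∀ k, X k ⊆ E ∪ E' := fun k => by
      simp only [hX]; split_ifs
      exacts [hUE, hVE, Set.empty_subset _]
    have hXd : Pairwise fun k l => Disjoint (X k) (X l) := fun k l hkl => by
      rcases eq_or_ne k i with rfl | hki
      · rcases eq_or_ne l j with rfl | hlj
        · simpa [hX, hkl.symm] using hUV
        · simp [hX, hkl.symm, hlj]
      · rcases eq_or_ne k j with rfl | hkj
        · rcases eq_or_ne l i with rfl | hli
          · simpa [hX, hkl] using hUV.symm
          · simp [hX, hkl.symm, hli]
        · simp [hX, hki, hkj]
    have hAX : ∀ k l, Disjoint (A k) (X l) := fun k l =>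
      Set.disjoint_left.2 fun x hx hx' => hAR k hx (hXE l hx')
    have hXt : ∀ k, unif.real (X k) = (if k = i then t else 0) + if k = j then t else 0 := by
      intro k
      rcases eq_or_ne k i with rfl | hki
      · simp [hX, hne, hUt]
      · rcases eq_or_ne k j with rfl | hkj
        · simp [hX, hki, hVt]
        · simp [hX, hki, hkj]
    have hXh : ∀ k, ∫ t in X k, h t ∂unif = (if k = i then ∫ t in U, h t ∂unif else 0) +
        if k = j then ∫ t in V, h t ∂unif else 0 := by
      intro k
      rcases eq_or_ne k i with rfl | hki
      · simp [hX, hne]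
      · rcases eq_or_ne k j with rfl | hkj
        · simp [hX, hki]
        · simp [hX, hki, hkj]
    have hm : ∀ k, unif.real (A k ∪ X k) = α k := fun k => by
      rw [measureReal_union (hAX k k) (hXm k), hAγ k (Finset.mem_univ k), hXt]
      ring
    have h0 := hQ (fun k => A k ∪ X k) (fun k => (hA k).union (hXm k)) (fun k l hkl => by
      simp only [Set.disjoint_union_left, Set.disjoint_union_right]
      exact ⟨⟨hAd hkl, (hAX l k).symm⟩, hAX k l, hXd hkl⟩) hm
    rw [boxIntegral_sum hh] at h0
    simp only [hm] at h0
    rw [Finset.sum_congr rfl fun k _ => by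
      rw [setIntegral_union (hAX k k) (hXm k) hh.integrableOn hh.integrableOn, hXh]] at h0
    simpa [mul_add, Finset.sum_add_distrib, add_assoc] using h0
  have k1 := key E E' hE hE' hd Set.subset_union_left Set.subset_union_right rfl heq.symm
  have k2 := key E' E hE' hE hd.symm Set.subset_union_right Set.subset_union_left heq.symm rfl
  have hP : (∏ l ∈ Finset.univ.erase i, α l) ≠ ∏ l ∈ Finset.univ.erase j, α l := by
    intro hP
    have h1 := Finset.mul_prod_erase Finset.univ α (Finset.mem_univ i)
    have h2 := Finset.mul_prod_erase Finset.univ α (Finset.mem_univ j)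
    rw [← h2, ← hP] at h1
    exact hij (mul_right_cancel₀ (Finset.prod_ne_zero_iff.2 fun k _ => (hα k).ne') h1)
  have : ((∏ l ∈ Finset.univ.erase i, α l) - ∏ l ∈ Finset.univ.erase j, α l) *
      (∫ t in E, h t ∂unif - ∫ t in E', h t ∂unif) = 0 := by linarith
  exact sub_eq_zero.1 ((mul_eq_zero.1 this).resolve_left (sub_ne_zero.2 hP))

lemma ae_eq_const_of_setIntegral_eq {C : ℝ} (hh : Measurable h) (hC : ∀ t, |h t| ≤ C) {t₀ : ℝ}
    (ht₀ : 0 < t₀)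
    (hsw : ∀ E E' : Set ℝ, MeasurableSet E → MeasurableSet E' → Disjoint E E' →
      unif.real E = unif.real E' → unif.real E ≤ t₀ →
      ∫ t in E, h t ∂unif = ∫ t in E', h t ∂unif) :
    h =ᵐ[unif] fun _ => ∫ t, h t ∂unif := by
  have hint : Integrable h unif := integrable_of_bounded hh hC
  have := (hint.sub (integrable_const (∫ t, h t ∂unif))).ae_eq_zero_of_forall_setIntegral_eq_zero
    fun s hs _ => ?_
  · filter_upwards [this] with t ht
    simpa [sub_eq_zero] using ht
  · have h1 := additive_eq_of_swap (B := Set.univ) (ν := fun E => ∫ t in E, h t ∂unif) (C := C)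
      MeasurableSet.univ
      (fun E _ _ => norm_setIntegral_le_of_norm_le_const (f := h) (measure_lt_top unif E)
        fun x _ => hC x)
      (fun E E' _ _ _ hE' hd => setIntegral_union hd hE' hint.integrableOn hint.integrableOn)
      ht₀ (fun E E' _ _ => hsw E E') hs (Set.subset_univ s)
    simp only [setIntegral_univ, probReal_univ, mul_one] at h1
    have h2 := integral_sub (μ := unif.restrict s) hint.restrict
      (integrable_const (∫ t, h t ∂unif))
    refine h2.trans ?_
    rw [setIntegral_const, h1, smul_eq_mul, mul_comm, sub_self]

end UnequalSides

/-- If `g` is symmetric and integrates to zero over all boxes with disjoint sides of prescribed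
lengths of total one, not all equal, then `g` vanishes almost everywhere. -/
lemma ae_eq_zero_of_boxIntegral_of_ne {m : ℕ} [NeZero m] {g : (Fin m → ℝ) → ℝ} {C : ℝ}
    (hg : Measurable g) (hC : ∀ x, |g x| ≤ C)
    (hsymm : ∀ (σ : Equiv.Perm (Fin m)) x, g (fun k => x (σ k)) = g x)
    {α : Fin m → ℝ} (hα : ∀ k, 0 < α k) (hα1 : ∑ k, α k = 1)
    (hQ : ∀ A : Fin m → Set ℝ, (∀ k, MeasurableSet (A k)) →
      Pairwise (fun i j => Disjoint (A i) (A j)) → (∀ k, unif.real (A k) = α k) →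
      boxIntegral g A = 0) {i j : Fin m} (hij : α i ≠ α j) : g =ᵐ[cube (Fin m)] 0 := by
  obtain ⟨h, D, hh, hD, hgh⟩ := exists_ae_eq_sum_same hg hC hsymm hα hα1 hQ
  have hconst := ae_eq_const_of_setIntegral_eq hh hD (lt_min (hα i) (hα j))
    fun E E' hE hE' hd heq hle => setIntegral_eq_of_boxIntegral_sum_eq_zero hα hα1
      (integrable_of_bounded hh hD)
      (fun A hA hAd hAα => (boxIntegral_congr_ae hgh A).symm.trans (hQ A hA hAd hAα))
      hij hE hE' hd heq hle
  set c := ∫ t, h t ∂unif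
  have hgc : g =ᵐ[cube (Fin m)] fun _ => m * c := by
    have : ∀ᵐ x ∂cube (Fin m), ∀ k, h (x k) = c := ae_all_iff.2 fun k =>
      (Measure.quasiMeasurePreserving_eval (fun _ => unif) k).ae hconst
    filter_upwards [hgh, this] with x hx hx'
    simp [hx, hx']
  obtain ⟨A, hA, -, hAd, hAα, -⟩ := exists_disjoint_family Finset.univ α (fun k _ => (hα k).le)
    MeasurableSet.univ (by simp [hα1])
  have h0 := hQ A hA hAd fun k => hAα k (Finset.mem_univ k)
  rw [boxIntegral_congr_ae hgc, boxIntegral_const, mul_eq_zero] at h0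
  have hc : m * c = 0 := h0.resolve_left <| Finset.prod_ne_zero_iff.2 fun k hk => by
    rw [hAα k hk]; exact (hα k).ne'
  filter_upwards [hgc] with x hx
  rw [hx, hc, Pi.zero_apply]

lemma setIntegral_iUnion_eq_integral {ι : Type*} [Fintype ι] {h : ℝ → ℝ}
    (hh : Integrable h unif) {A : ι → Set ℝ} (hA : ∀ k, MeasurableSet (A k))
    (hd : Pairwise fun i j => Disjoint (A i) (A j)) (hsum : ∑ k, unif.real (A k) = 1) :
    ∑ k, ∫ t in A k, h t ∂unif = ∫ t, h t ∂unif := by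
  rw [← integral_iUnion_fintype hA hd fun k => hh.integrableOn]
  have hU : MeasurableSet (⋃ k, A k) := MeasurableSet.iUnion hA
  have h1 : unif.real (⋃ k, A k) = 1 := by
    rw [measureReal_iUnion_fintype hd hA, hsum]
  have : (⋃ k, A k : Set ℝ) =ᵐ[unif] Set.univ := by
    rw [ae_eq_univ, prob_compl_eq_zero_iff hU]
    simpa [Measure.real, ENNReal.toReal_eq_one_iff] using h1
  rw [setIntegral_congr_set this, setIntegral_univ]

section PsiSym

variable {m : ℕ} {F : SimpleGraph (Fin m)} {W : ℝ → ℝ → ℝ}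

lemma measurable_psi (hW : IsGraphon W) : Measurable (psi F W) := by
  classical
  refine Finset.measurable_prod _ fun i _ => Finset.measurable_prod _ fun j _ => ?_
  split_ifs
  · have : Measurable fun x : Fin m → ℝ => (x i, x j) := by fun_prop
    exact hW.1.comp this
  · exact measurable_const

lemma abs_psi_le (hW : IsGraphon W) (x : Fin m → ℝ) : |psi F W x| ≤ 1 := by
  classical
  simp only [psi, Finset.abs_prod]
  refine Finset.prod_le_one (fun _ _ => Finset.prod_nonneg fun _ _ => abs_nonneg _) fun i _ =>
    Finset.prod_le_one (fun _ _ => abs_nonneg _) fun j _ => ?_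
  split_ifs
  · rw [abs_of_nonneg (hW.2.2 _ _).1]
    exact (hW.2.2 _ _).2
  · simp

lemma measurable_psiSym (hW : IsGraphon W) : Measurable (psiSym F W) :=
  (Finset.measurable_sum _ fun _ _ => (measurable_psi hW).comp (by fun_prop)).const_mul _

lemma abs_psiSym_le (hW : IsGraphon W) (x : Fin m → ℝ) : |psiSym F W x| ≤ 1 := by
  rw [psiSym, abs_mul, abs_inv, Nat.abs_cast, inv_mul_le_iff₀ (by positivity)]
  refine (Finset.abs_sum_le_sum_abs _ _).trans
    ((Finset.sum_le_sum fun σ _ => abs_psi_le hW _).trans ?_)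
  simp [Fintype.card_perm]

lemma psiSym_comp_perm (σ : Equiv.Perm (Fin m)) (x : Fin m → ℝ) :
    psiSym F W (fun k => x (σ k)) = psiSym F W x := by
  simp only [psiSym]
  congr 1
  exact Equiv.sum_comp (Equiv.mulLeft σ) fun τ => psi F W fun i => x (τ i)

lemma volume_restrict_pi_inter_Icc (A : Fin m → Set ℝ) :
    volume.restrict (Set.univ.pi fun k => A k ∩ Set.Icc 0 1) =
      (cube (Fin m)).restrict (Set.univ.pi A) := by
  rw [volume_pi, Measure.restrict_pi_pi, Measure.restrict_pi_pi]
  congr 1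
  ext1 k
  rw [Measure.restrict_restrict' measurableSet_Icc]

lemma volume_restrict_unitBox : volume.restrict (unitBox m) = cube (Fin m) := by
  have := volume_restrict_pi_inter_Icc (m := m) fun _ => Set.univ
  simpa [unitBox, Set.pi_univ] using this

lemma boxIntegral_sub_const (hW : IsGraphon W) (c : ℝ) (A : Fin m → Set ℝ) :
    boxIntegral (fun x => psiSym F W x - c) A =
      boxIntegral (psiSym F W) A - c * ∏ k, unif.real (A k) := by
  have h1 := boxIntegral_const (ι := Fin m) c A
  rw [boxIntegral] at h1 ⊢
  rw [integral_sub (integrable_of_bounded (measurable_psiSym hW) (abs_psiSym_le hW))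
    (integrable_const c), h1, boxIntegral, mul_comm c]

lemma graphonPt_iff (hW : IsGraphon W) {p : ℝ} {α : Fin m → ℝ} (hα : ∀ i, 0 ≤ α i) :
    GraphonPt F W p α ↔ ∀ A : Fin m → Set ℝ, (∀ k, MeasurableSet (A k)) →
      Pairwise (fun i j => Disjoint (A i) (A j)) → (∀ k, unif.real (A k) = α k) →
      boxIntegral (fun x => psiSym F W x - p ^ numEdges F) A = 0 := by
  constructor
  · intro h A hA hd hm
    have := h (fun k => A k ∩ Set.Icc 0 1) (fun k => (hA k).inter measurableSet_Icc)
      (fun k => Set.inter_subset_right)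
      (fun i j hij => (hd hij).mono Set.inter_subset_left Set.inter_subset_left) fun k => by
        rw [← Measure.restrict_apply (hA k), ← hm k, ofReal_measureReal]
    rw [volume_restrict_pi_inter_Icc] at this
    rw [boxIntegral_sub_const hW, boxIntegral, this]
    simp [hm]
  · intro h A hA hAs hd hm
    have hm' : ∀ k, unif.real (A k) = α k := fun k => by
      rw [Measure.real, Measure.restrict_apply (hA k), Set.inter_eq_left.2 (hAs k), hm k,
        ENNReal.toReal_ofReal (hα k)]
    have h0 := h A hA hd hm'
    rw [boxIntegral_sub_const hW, sub_eq_zero] at h0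
    simp only [hm'] at h0
    rw [← h0, boxIntegral, ← volume_restrict_pi_inter_Icc]
    simp only [Set.inter_eq_left.2 (hAs _)]

end PsiSym

/-- **Lemma (LW).** (a) If `(α₁,…,α_m) ≠ (1/m,…,1/m)`, then `P̃^W(F;α)` holds iff
`Ψ̃_{F,W} = p^(e F)` a.e. on `[0,1]^m`. (b) If `(α₁,…,α_m) = (1/m,…,1/m)`, then
`P̃^W(F;α)` holds iff `Ψ̃_{F,W}(x) = ∑ h(x_i)` a.e. for some integrable `h` with
`∫ h = p^(e F)/m`. -/
theorem stmt10 {m : ℕ} (hm : 1 ≤ m) (F : SimpleGraph (Fin m)) (W : ℝ → ℝ → ℝ)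
    (hW : IsGraphon W) (p : ℝ) (hp0 : 0 ≤ p) (hp1 : p ≤ 1)
    (α : Fin m → ℝ) (hα : ∀ i, α i ∈ Set.Ioo (0 : ℝ) 1) (hsum : ∑ i, α i ≤ 1) :
    ((α ≠ fun _ => 1 / (m : ℝ)) →
      (GraphonPt F W p α ↔
        psiSym F W =ᵐ[volume.restrict (unitBox m)] fun _ => p ^ numEdges F))
    ∧ ((α = fun _ => 1 / (m : ℝ)) →
      (GraphonPt F W p α ↔
        ∃ h : ℝ → ℝ, IntegrableOn h (Set.Icc 0 1) ∧
          (∫ x in Set.Icc (0 : ℝ) 1, h x = p ^ numEdges F / m) ∧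
          psiSym F W =ᵐ[volume.restrict (unitBox m)] fun x => ∑ i, h (x i))) := by
  have : NeZero m := ⟨by omega⟩
  have hm0 : (m : ℝ) ≠ 0 := NeZero.ne _
  have hα0 : ∀ i, 0 < α i := fun i => (hα i).1
  set c := p ^ numEdges F with hc
  have hg : Measurable fun x => psiSym F W x - c := (measurable_psiSym hW).sub_const _
  have hC : ∀ x, |psiSym F W x - c| ≤ 1 + |c| := fun x =>
    (abs_sub _ _).trans (add_le_add_left (abs_psiSym_le hW x) _)
  have hsymm : ∀ (σ : Equiv.Perm (Fin m)) x,
      psiSym F W (fun k => x (σ k)) - c = psiSym F W x - c := fun σ x => by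
    rw [psiSym_comp_perm]
  rw [graphonPt_iff hW fun i => (hα0 i).le, volume_restrict_unitBox]
  refine ⟨fun hne => ⟨fun hQ => ?_, fun hae A _ _ _ => ?_⟩, fun heq => ⟨fun hQ => ?_, ?_⟩⟩
  · suffices h : (fun x => psiSym F W x - c) =ᵐ[cube (Fin m)] 0 by
      filter_upwards [h] with x hx
      exact sub_eq_zero.1 hx
    rcases hsum.lt_or_eq with hlt | h1
    · exact ae_eq_zero_of_boxIntegral hg hC hα0 hlt hQ
    · by_cases hall : ∀ i j, α i = α j
      · refine absurd (funext fun i => ?_) hne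
        rw [Finset.sum_congr rfl fun j _ => hall j i] at h1
        simp only [Finset.sum_const, Finset.card_univ, Fintype.card_fin, nsmul_eq_mul] at h1
        rw [eq_div_iff hm0, mul_comm, h1]
      · push Not at hall
        obtain ⟨i, j, hij⟩ := hall
        exact ae_eq_zero_of_boxIntegral_of_ne hg hC hsymm hα0 h1 hQ hij
  · have h : (fun x => psiSym F W x - c) =ᵐ[cube (Fin m)] fun _ => 0 := by
      filter_upwards [hae] with x hx
      rw [hx, sub_self]
    rw [boxIntegral_congr_ae h, boxIntegral_const, mul_zero]
  · have h1 : ∑ i, α i = 1 := by simp [heq, hm0]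
    obtain ⟨h, D, hh, hD, hgh⟩ := exists_ae_eq_sum_same hg hC hsymm hα0 h1 hQ
    have hint : Integrable h unif := integrable_of_bounded hh hD
    obtain ⟨A, hA, -, hAd, hAα, -⟩ := exists_disjoint_family Finset.univ α (fun k _ => (hα0 k).le)
      MeasurableSet.univ (by simp [h1])
    replace hAα := fun k => hAα k (Finset.mem_univ k)
    have h0 := (boxIntegral_congr_ae hgh A).symm.trans (hQ A hA hAd hAα)
    have hU := setIntegral_iUnion_eq_integral hint hA hAd (by simp only [hAα, h1])
    rw [boxIntegral_sum hint] at h0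
    simp only [hAα, heq, Finset.prod_const, Finset.card_erase_of_mem (Finset.mem_univ _)] at h0
    rw [← Finset.mul_sum, hU, mul_eq_zero] at h0
    have hzero : ∫ t, h t ∂unif = 0 := h0.resolve_left (pow_ne_zero _ (one_div_ne_zero hm0))
    refine ⟨fun t => h t + c / m, hint.add (integrable_const _), ?_, ?_⟩
    · rw [integral_add hint (integrable_const _), hzero, integral_const]
      simp
    · filter_upwards [hgh] with x hx
      rw [Finset.sum_add_distrib, ← hx, Finset.sum_const, Finset.card_univ, Fintype.card_fin,
        nsmul_eq_mul, mul_div_cancel₀ _ hm0, sub_add_cancel]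
  · rintro ⟨h, hint, hhc, hae⟩ A hA hAd hAα
    have h1 : ∑ i, α i = 1 := by simp [heq, hm0]
    have hU := setIntegral_iUnion_eq_integral hint hA hAd (by simp only [hAα, h1])
    rw [boxIntegral_sub_const hW, boxIntegral_congr_ae hae, boxIntegral_sum hint]
    simp only [hAα, heq, Finset.prod_const, Finset.card_erase_of_mem (Finset.mem_univ _)]
    rw [← Finset.mul_sum, hU, hhc, Finset.card_univ, Fintype.card_fin]
    obtain ⟨n, rfl⟩ : ∃ n, m = n + 1 := ⟨m - 1, by omega⟩
    rw [Nat.add_sub_cancel, pow_succ]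
    ring
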